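/- Let d ≥ 1 and let a_1,…,a_{d+1} ∈ ℝ^d be affinely independent points with simplex C = convexHull{a_1,…,a_{d+1}}, and let r be the inradius of C. Then for every point p ∈ C there exists an index k ∈ {1,…,d+1} such that the Euclidean distance from p to the affine span of {a_i : i ≠ k} is at most r. -/

import Mathlib

/-- The inradius of a set `C ⊆ ℝ^d`: the supremum of all `r ≥ 0` such that some closed
Euclidean ball of radius `r` is contained in `C`. -/
noncomputable def inradius {d : ℕ} (C : Set (EuclideanSpace ℝ (Fin d))) : ℝ :=
  sSup {r : ℝ | 0 ≤ r ∧ ∃ c, Metric.closedBall c r ⊆ C}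

namespace Affine.Simplex

variable {V P : Type*} [NormedAddCommGroup V] [InnerProductSpace ℝ V] [MetricSpace P]
  [NormedAddTorsor V P] {n : ℕ} [NeZero n]

theorem signedInfDist_affineCombination_eq_mul_height (s : Simplex ℝ P n) (i : Fin (n + 1))
    {w : Fin (n + 1) → ℝ} (hw : ∑ j, w j = 1) :
    s.signedInfDist i (Finset.univ.affineCombination ℝ s.points w) = w i * s.height i := by
  rw [signedInfDist_affineCombination _ _ hw, height, altitudeFoot, dist_eq_norm_vsub V]

theorem abs_signedInfDist_sub_le_dist (s : Simplex ℝ P n) (i : Fin (n + 1)) (x y : P) :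
    |s.signedInfDist i y - s.signedInfDist i x| ≤ dist x y := by
  rw [signedInfDist, AffineSubspace.signedInfDist_def, signedDist_triangle_left]
  exact abs_signedDist_le_dist _ _ _

theorem mem_closedInterior_iff_forall_signedInfDist_nonneg (s : Simplex ℝ P n) {x : P}
    (hx : x ∈ affineSpan ℝ (Set.range s.points)) :
    x ∈ s.closedInterior ↔ ∀ i, 0 ≤ s.signedInfDist i x := by
  obtain ⟨w, hw, rfl⟩ := eq_affineCombination_of_mem_affineSpan_of_fintype hx
  simp only [affineCombination_mem_closedInterior_iff hw,
    s.signedInfDist_affineCombination_eq_mul_height _ hw, mul_nonneg_iff_of_pos_right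
    (s.height_pos _)]
  refine ⟨fun h i ↦ (h i).1, fun h i ↦ ⟨h i, ?_⟩⟩
  rw [← hw]
  exact Finset.single_le_sum (fun j _ ↦ h j) (Finset.mem_univ i)

theorem closedBall_incenter_inradius_subset_closedInterior (s : Simplex ℝ P n)
    (hs : affineSpan ℝ (Set.range s.points) = ⊤) :
    Metric.closedBall s.incenter s.inradius ⊆ s.closedInterior := by
  intro x hx
  rw [mem_closedInterior_iff_forall_signedInfDist_nonneg s (hs ▸ AffineSubspace.mem_top ℝ V x)]
  intro i
  have h := (abs_le.1 (s.abs_signedInfDist_sub_le_dist i x s.incenter)).2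
  rw [signedInfDist_incenter] at h
  linarith [Metric.mem_closedBall.1 hx]

theorem exists_signedInfDist_le_inradius (s : Simplex ℝ P n) {x : P}
    (hx : x ∈ affineSpan ℝ (Set.range s.points)) :
    ∃ i, s.signedInfDist i x ≤ s.inradius := by
  obtain ⟨w, hw, rfl⟩ := eq_affineCombination_of_mem_affineSpan_of_fintype hx
  by_contra! h
  simp only [s.signedInfDist_affineCombination_eq_mul_height _ hw] at h
  have hpos := s.sum_excenterWeightsUnnorm_empty_pos
  have hlt : ∑ i, s.inradius * s.excenterWeightsUnnorm ∅ i < ∑ i, w i :=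
    Finset.sum_lt_sum_of_nonempty Finset.univ_nonempty fun i _ ↦ by
      rw [excenterWeightsUnnorm_empty_apply, ← div_eq_mul_inv, div_lt_iff₀ (s.height_pos i)]
      exact h i
  rw [← Finset.mul_sum, inradius_eq_abs_inv_sum, abs_of_pos (inv_pos.2 hpos),
    inv_mul_cancel₀ hpos.ne', hw] at hlt
  exact lt_irrefl _ hlt

theorem infDist_affineSpan_image_compl_le_abs_signedInfDist (s : Simplex ℝ P n)
    (i : Fin (n + 1)) {x : P} (hx : x ∈ affineSpan ℝ (Set.range s.points)) :
    Metric.infDist x (affineSpan ℝ (s.points '' {i}ᶜ) : Set P) ≤ |s.signedInfDist i x| := by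
  rw [abs_signedInfDist_eq_dist_of_mem_affineSpan_range _ hx]
  refine Metric.infDist_le_dist_of_mem ?_
  rw [← range_faceOpposite_points]
  exact SetLike.coe_mem _

end Affine.Simplex

theorem bddAbove_radius_closedBall_subset {E : Type*} [NormedAddCommGroup E] [NormedSpace ℝ E]
    [Nontrivial E] {C : Set E} (hC : Bornology.IsBounded C) :
    BddAbove {r : ℝ | 0 ≤ r ∧ ∃ c, Metric.closedBall c r ⊆ C} := by
  refine ⟨Metric.diam C / 2, ?_⟩
  rintro r ⟨hr, c, hc⟩
  have h := Metric.diam_mono hc hC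
  rw [Metric.diam_closedBall_eq c hr] at h
  linarith

theorem le_inradius {d : ℕ} [NeZero d] {C : Set (EuclideanSpace ℝ (Fin d))}
    (hC : Bornology.IsBounded C) {r : ℝ} (hr : 0 ≤ r) {c : EuclideanSpace ℝ (Fin d)}
    (hc : Metric.closedBall c r ⊆ C) : r ≤ inradius C :=
  le_csSup (bddAbove_radius_closedBall_subset hC) ⟨hr, c, hc⟩

/-- For affinely independent `a_1, …, a_{d+1} ∈ ℝ^d` with simplex
`C = convexHull {a_1, …, a_{d+1}}` of inradius `r`, every point `p ∈ C` is at Euclidean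
distance at most `r` from the affine span of some facet `{a_i : i ≠ k}`. -/
theorem exists_facet_span_dist_le_inradius (d : ℕ) (hd : 1 ≤ d)
    (a : Fin (d + 1) → EuclideanSpace ℝ (Fin d)) (ha : AffineIndependent ℝ a)
    (p : EuclideanSpace ℝ (Fin d)) (hp : p ∈ convexHull ℝ (Set.range a)) :
    ∃ k : Fin (d + 1),
      Metric.infDist p ((affineSpan ℝ (a '' {i | i ≠ k}) : Set (EuclideanSpace ℝ (Fin d))))
        ≤ inradius (convexHull ℝ (Set.range a)) := by
  have : NeZero d := ⟨by omega⟩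
  let s : Affine.Simplex ℝ (EuclideanSpace ℝ (Fin d)) d := ⟨a, ha⟩
  have hs : affineSpan ℝ (Set.range s.points) = ⊤ :=
    ha.affineSpan_eq_top_iff_card_eq_finrank_add_one.2 (by simp)
  have hC : convexHull ℝ (Set.range a) = s.closedInterior := s.convexHull_eq_closedInterior
  have hps : p ∈ affineSpan ℝ (Set.range s.points) := convexHull_subset_affineSpan _ hp
  obtain ⟨k, hk⟩ := s.exists_signedInfDist_le_inradius hps
  refine ⟨k, (s.infDist_affineSpan_image_compl_le_abs_signedInfDist k hps).trans ?_⟩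
  rw [hC, s.mem_closedInterior_iff_forall_signedInfDist_nonneg hps] at hp
  rw [abs_of_nonneg (hp k)]
  refine hk.trans (le_inradius ?_ s.inradius_pos.le (c := s.incenter) ?_)
  · exact isBounded_convexHull.2 (Set.finite_range a).isBounded
  · rw [hC]
    exact s.closedBall_incenter_inradius_subset_closedInterior hs
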